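/- Let X be a complex Banach space, Ω ⊆ ℂ open, and for z ∈ Ω let T_z be a C₀-semigroup on X with generator A_z such that sup{e^{−ωt}‖T_z(t)‖ : t ≥ 0, z ∈ Ω} =: M < ∞ for some ω ∈ ℝ. Assume z ↦ (λ − A_z)⁻¹ ∈ L(X) is holomorphic for some λ > ω. Then for every t ≥ 0 the map Ω ∋ z ↦ T_z(t) ∈ L(X) is holomorphic, and for every x ∈ X and t₁ > 0 the map Ω ∋ z ↦ T_z(·)x ∈ C([0,t₁]; X) is holomorphic. -/

import Mathlib

open Filter

/-- `(x, y)` belongs to the graph of the generator of the semigroup `T`. -/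
def IsGenPoint {X : Type*} [NormedAddCommGroup X] [NormedSpace ℂ X]
    (T : ℝ → X →L[ℂ] X) (x y : X) : Prop :=
  Tendsto (fun t : ℝ => (t : ℂ)⁻¹ • (T t x - x)) (nhdsWithin 0 (Set.Ioi 0)) (nhds y)

section HolomorphicSemigroups

open MeasureTheory Metric Topology

/-- A function given on a disc by its Cauchy integral is differentiable at the center. -/
lemma differentiableAt_of_cauchy_formula {E : Type*} [NormedAddCommGroup E] [NormedSpace ℂ E]
    [CompleteSpace E] {f : ℂ → E} {c : ℂ} {r : ℝ} (hr : 0 < r) (hf : CircleIntegrable f c r)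
    (hcauchy : ∀ w ∈ ball c r,
      ((2 * Real.pi * Complex.I : ℂ)⁻¹ • ∮ z in C(c, r), (z - w)⁻¹ • f z) = f w) :
    DifferentiableAt ℂ f c := by
  lift r to NNReal using hr.le
  have h := (hasFPowerSeriesOn_cauchy_integral hf hr).differentiableOn.differentiableAt
    (x := c) (Metric.eball_mem_nhds c (by simpa using hr))
  refine h.congr_of_eventuallyEq ?_
  filter_upwards [ball_mem_nhds c hr] with w hw
  exact (hcauchy w hw).symm

/-- A pointwise limit of a uniformly bounded sequence of holomorphic functions is holomorphic. -/
lemma differentiableOn_of_tendsto_of_bounded {E : Type*} [NormedAddCommGroup E] [NormedSpace ℂ E]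
    [CompleteSpace E] {Ω : Set ℂ} (hΩ : IsOpen Ω) {F : ℕ → ℂ → E} {f : ℂ → E} {C : ℝ}
    (hF : ∀ n, DifferentiableOn ℂ (F n) Ω) (hC : ∀ n, ∀ z ∈ Ω, ‖F n z‖ ≤ C)
    (hlim : ∀ z ∈ Ω, Tendsto (fun n => F n z) atTop (𝓝 (f z))) :
    DifferentiableOn ℂ f Ω := by
  intro c hc
  obtain ⟨r, hr, hball⟩ := nhds_basis_closedBall.mem_iff.1 (hΩ.mem_nhds hc)
  have hsphere (θ : ℝ) : circleMap c r θ ∈ Ω :=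
    hball (circleMap_mem_closedBall c hr.le θ)
  have hcont (n : ℕ) : Continuous fun θ => F n (circleMap c r θ) :=
    (hF n).continuousOn.comp_continuous (continuous_circleMap c r) hsphere
  have hmeas : MeasureTheory.StronglyMeasurable fun θ => f (circleMap c r θ) :=
    stronglyMeasurable_of_tendsto atTop (fun n => (hcont n).stronglyMeasurable)
      (tendsto_pi_nhds.2 fun θ => hlim _ (hsphere θ))
  have hbound : ∀ z ∈ Ω, ‖f z‖ ≤ C := fun z hz =>
    le_of_tendsto (hlim z hz).norm (Eventually.of_forall fun n => hC n z hz)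
  have hint : CircleIntegrable f c r :=
    (intervalIntegrable_const (c := C)).mono_fun hmeas.aestronglyMeasurable
      (Eventually.of_forall fun θ =>
        (hbound _ (hsphere θ)).trans (Real.le_norm_self C))
  refine (differentiableAt_of_cauchy_formula hr hint fun w hw => ?_).differentiableWithinAt
  have hw0 (θ : ℝ) : circleMap c r θ - w ≠ 0 := fun h =>  by
    have := circleMap_mem_sphere c hr.le θ
    rw [sub_eq_zero.1 h, mem_sphere] at this
    exact (mem_ball.1 hw).ne this
  have hker : Continuous fun θ => ‖deriv (circleMap c r) θ‖ * ‖(circleMap c r θ - w)⁻¹‖ * C := by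
    simp only [deriv_circleMap]
    have := ((continuous_circleMap c r).sub continuous_const).inv₀ hw0
    fun_prop
  have hleft : Tendsto (fun n => (2 * Real.pi * Complex.I : ℂ)⁻¹ •
      ∮ z in C(c, r), (z - w)⁻¹ • F n z) atTop
      (𝓝 ((2 * Real.pi * Complex.I : ℂ)⁻¹ • ∮ z in C(c, r), (z - w)⁻¹ • f z)) := by
    refine Tendsto.const_smul ?_ _
    refine intervalIntegral.tendsto_integral_filter_of_dominated_convergence _
      (Eventually.of_forall fun n => ?_) (Eventually.of_forall fun n =>
        Eventually.of_forall fun θ _ => ?_) (hker.intervalIntegrable _ _)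
      (Eventually.of_forall fun θ _ => ?_)
    · refine Continuous.aestronglyMeasurable ?_
      have h1 := ((continuous_circleMap c r).sub continuous_const).inv₀ hw0
      have h2 := hcont n
      simp only [deriv_circleMap]
      exact (by fun_prop : Continuous fun θ => circleMap 0 r θ * Complex.I).smul (h1.smul h2)
    · rw [norm_smul, norm_smul, mul_assoc]
      have := hC n _ (hsphere θ)
      gcongr
    · exact ((hlim _ (hsphere θ)).const_smul _).const_smul _
  refine tendsto_nhds_unique hleft ((hlim w (hball (ball_subset_closedBall hw))).congr fun n => ?_)
  exact (((hF n).mono hball).diffContOnCl_ball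
    le_rfl).two_pi_i_inv_smul_circleIntegral_sub_inv_smul hw |>.symm

/-- A bounded function is holomorphic as soon as its compositions with a norming family of
operators are. -/
lemma differentiableOn_of_norming {ι E Y : Type*} [NormedAddCommGroup E] [NormedSpace ℂ E]
    [CompleteSpace E] [NormedAddCommGroup Y] [NormedSpace ℂ Y] [CompleteSpace Y]
    {Ω : Set ℂ} (hΩ : IsOpen Ω) (φ : ι → E →L[ℂ] Y)
    (hφ : ∀ e : E, ∀ C : ℝ, 0 ≤ C → (∀ i, ‖φ i e‖ ≤ C) → ‖e‖ ≤ C) {F : ℂ → E} {C : ℝ}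
    (hF : ∀ i, DifferentiableOn ℂ (fun z => φ i (F z)) Ω)
    (hC : ∀ i, ∀ z ∈ Ω, ‖φ i (F z)‖ ≤ C) : DifferentiableOn ℂ F Ω := by
  have hC' (i : ι) (z : ℂ) (hz : z ∈ Ω) : ‖φ i (F z)‖ ≤ |C| := (hC i z hz).trans (le_abs_self C)
  have hcont : ContinuousOn F Ω := by
    intro c hc
    obtain ⟨r, hr, hball⟩ := nhds_basis_ball.mem_iff.1 (hΩ.mem_nhds hc)
    refine ContinuousAt.continuousWithinAt (tendsto_iff_dist_tendsto_zero.2 ?_)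
    have hlim : Tendsto (fun z => (2 * |C|) / r * dist z c) (𝓝 c) (𝓝 0) := by
      have : Continuous fun z => (2 * |C|) / r * dist z c := by fun_prop
      simpa using this.tendsto c
    refine squeeze_zero' (Eventually.of_forall fun z => dist_nonneg) ?_ hlim
    filter_upwards [ball_mem_nhds c hr] with z hz
    rw [dist_eq_norm]
    refine hφ _ _ (by positivity) fun i => ?_
    rw [map_sub, ← dist_eq_norm]
    refine Complex.dist_le_div_mul_dist_of_mapsTo_ball ((hF i).mono hball) (fun w hw => ?_) hz
    rw [mem_closedBall, dist_eq_norm]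
    linarith [norm_sub_le (φ i (F w)) (φ i (F c)), hC' i w (hball hw), hC' i c hc]
  intro c hc
  obtain ⟨r, hr, hball⟩ := nhds_basis_closedBall.mem_iff.1 (hΩ.mem_nhds hc)
  have hint : ContinuousOn F (sphere c r) := hcont.mono (sphere_subset_closedBall.trans hball)
  refine (differentiableAt_of_cauchy_formula hr (hint.circleIntegrable hr.le)
    fun w hw => ?_).differentiableWithinAt
  rw [← sub_eq_zero, ← norm_le_zero_iff]
  refine hφ _ _ le_rfl fun i => ?_
  rw [norm_le_zero_iff, map_sub, sub_eq_zero, map_smul]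
  have hw0 : ∀ z ∈ sphere c r, z - w ≠ 0 := fun z hz h => by
    rw [sub_eq_zero.1 h, mem_sphere] at hz
    exact (mem_ball.1 hw).ne hz
  have hint' : CircleIntegrable (fun z => (z - w)⁻¹ • F z) c r :=
    (((continuousOn_id.sub continuousOn_const).inv₀ hw0).smul hint).circleIntegrable hr.le
  have key := (((hF i).mono hball).diffContOnCl_ball
    le_rfl).two_pi_i_inv_smul_circleIntegral_sub_inv_smul hw
  rw [← key]
  congr 1
  rw [circleIntegral, circleIntegral, ← ContinuousLinearMap.intervalIntegral_comp_comm _ hint'.out]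
  simp

variable {X : Type*} [NormedAddCommGroup X] [NormedSpace ℂ X]

/-- `S` is a `C₀`-semigroup with `‖S(t)‖ ≤ M e^{ωt}`. -/
structure IsExpBoundedSemigroup (S : ℝ → X →L[ℂ] X) (M ω : ℝ) : Prop where
  zero : S 0 = 1
  add : ∀ s t : ℝ, 0 ≤ s → 0 ≤ t → S (s + t) = (S s).comp (S t)
  cont : ∀ x : X, ContinuousOn (fun t : ℝ => S t x) (Set.Ici 0)
  bound : ∀ t : ℝ, 0 ≤ t → ‖S t‖ ≤ M * Real.exp (ω * t)

namespace IsExpBoundedSemigroup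

variable {S : ℝ → X →L[ℂ] X} {M ω : ℝ}

lemma norm_apply_le (hS : IsExpBoundedSemigroup S M ω) {t : ℝ} (ht : 0 ≤ t) (x : X) :
    ‖S t x‖ ≤ M * Real.exp (ω * t) * ‖x‖ :=
  (S t).le_of_opNorm_le (hS.bound t ht) x

lemma norm_smul_apply_le (hS : IsExpBoundedSemigroup S M ω) (f : ℝ → ℝ) {t : ℝ} (ht : 0 ≤ t)
    (x : X) : ‖f t • S t x‖ ≤ M * ‖x‖ * ‖f t * Real.exp (ω * t)‖ := by
  rw [norm_smul, norm_mul, Real.norm_of_nonneg (Real.exp_pos _).le]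
  calc ‖f t‖ * ‖S t x‖ ≤ ‖f t‖ * (M * Real.exp (ω * t) * ‖x‖) := by
        gcongr; exact hS.norm_apply_le ht x
    _ = _ := by ring

lemma continuous_extend (hS : IsExpBoundedSemigroup S M ω) (x : X) :
    Continuous fun t => S (max t 0) x :=
  (hS.cont x).comp_continuous (f := fun t : ℝ => max t 0) (by fun_prop) fun t => le_max_right t 0

lemma integrableOn_smul (hS : IsExpBoundedSemigroup S M ω) {f : ℝ → ℝ}
    (hf : IntegrableOn (fun s => f s * Real.exp (ω * s)) (Set.Ioi 0)) (x : X) :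
    IntegrableOn (fun s => f s • S s x) (Set.Ioi 0) := by
  have hfm : AEStronglyMeasurable f (volume.restrict (Set.Ioi 0)) := by
    have hexp : Continuous fun s => Real.exp (-(ω * s)) := by fun_prop
    refine (hf.aestronglyMeasurable.mul hexp.aestronglyMeasurable).congr
      (Eventually.of_forall fun s => ?_)
    simp [mul_assoc, ← Real.exp_add]
  refine Integrable.mono' (hf.norm.const_mul (M * ‖x‖)) (hfm.smul
    (((hS.cont x).mono Set.Ioi_subset_Ici_self).aestronglyMeasurable measurableSet_Ioi))
    ((ae_restrict_iff' measurableSet_Ioi).2 (Eventually.of_forall fun s hs => ?_))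
  exact hS.norm_smul_apply_le f (le_of_lt hs) x

lemma norm_integral_le (hS : IsExpBoundedSemigroup S M ω) {f : ℝ → ℝ}
    (hf : IntegrableOn (fun s => f s * Real.exp (ω * s)) (Set.Ioi 0)) (x : X) :
    ‖∫ s in Set.Ioi 0, f s • S s x‖ ≤
      (M * ∫ s in Set.Ioi 0, ‖f s * Real.exp (ω * s)‖) * ‖x‖ := by
  refine (norm_integral_le_of_norm_le (hf.norm.const_mul (M * ‖x‖))
    ((ae_restrict_iff' measurableSet_Ioi).2 (Eventually.of_forall fun s hs =>
      hS.norm_smul_apply_le f (le_of_lt hs) x))).trans_eq ?_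
  rw [integral_const_mul]
  ring

/-- The operator `x ↦ ∫₀^∞ f(s) S(s) x ds`. -/
noncomputable def weightedIntegral (hS : IsExpBoundedSemigroup S M ω) {f : ℝ → ℝ}
    (hf : IntegrableOn (fun s => f s * Real.exp (ω * s)) (Set.Ioi 0)) : X →L[ℂ] X :=
  LinearMap.mkContinuous
    { toFun := fun x => ∫ s in Set.Ioi 0, f s • S s x
      map_add' := fun x y => by
        simp only [map_add, smul_add]
        exact integral_add (hS.integrableOn_smul hf x) (hS.integrableOn_smul hf y)
      map_smul' := fun c x => by
        simp only [map_smul, RingHom.id_apply, smul_comm _ c]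
        exact integral_smul c _ } _ (hS.norm_integral_le hf)

lemma weightedIntegral_apply (hS : IsExpBoundedSemigroup S M ω) {f : ℝ → ℝ}
    (hf : IntegrableOn (fun s => f s * Real.exp (ω * s)) (Set.Ioi 0)) (x : X) :
    hS.weightedIntegral hf x = ∫ s in Set.Ioi 0, f s • S s x := rfl

lemma map_weightedIntegral [CompleteSpace X] (hS : IsExpBoundedSemigroup S M ω) {f : ℝ → ℝ}
    (hf : IntegrableOn (fun s => f s * Real.exp (ω * s)) (Set.Ioi 0)) (A : X →L[ℂ] X) (x : X) :
    A (hS.weightedIntegral hf x) = ∫ s in Set.Ioi 0, f s • A (S s x) := by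
  rw [weightedIntegral_apply, ← A.integral_comp_comm (hS.integrableOn_smul hf x)]
  simp only [ContinuousLinearMap.map_smul_of_tower]

lemma commute_of_commute [CompleteSpace X] (hS : IsExpBoundedSemigroup S M ω) {f : ℝ → ℝ}
    (hf : IntegrableOn (fun s => f s * Real.exp (ω * s)) (Set.Ioi 0)) {A : X →L[ℂ] X}
    (hA : ∀ s, 0 ≤ s → Commute A (S s)) : Commute A (hS.weightedIntegral hf) := by
  ext x
  change A (hS.weightedIntegral hf x) = hS.weightedIntegral hf (A x)
  rw [map_weightedIntegral, weightedIntegral_apply]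
  refine setIntegral_congr_fun measurableSet_Ioi fun s hs => ?_
  exact congrArg (f s • ·) (DFunLike.congr_fun (hA s (le_of_lt hs)).eq x)

lemma commute_weightedIntegral [CompleteSpace X] (hS : IsExpBoundedSemigroup S M ω) {f g : ℝ → ℝ}
    (hf : IntegrableOn (fun s => f s * Real.exp (ω * s)) (Set.Ioi 0))
    (hg : IntegrableOn (fun s => g s * Real.exp (ω * s)) (Set.Ioi 0)) :
    Commute (hS.weightedIntegral hf) (hS.weightedIntegral hg) := by
  refine hS.commute_of_commute hg fun s hs => (hS.commute_of_commute hf fun t ht => ?_).symm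
  change (S s).comp (S t) = (S t).comp (S s)
  rw [← hS.add s t hs ht, ← hS.add t s ht hs, add_comm]

end IsExpBoundedSemigroup

lemma integrableOn_exp_mul_exp {μ ω : ℝ} (h : ω < μ) :
    IntegrableOn (fun s => Real.exp (-μ * s) * Real.exp (ω * s)) (Set.Ioi 0) := by
  refine (integrableOn_exp_mul_Ioi (sub_neg.2 h) 0).congr_fun (fun s _ => ?_) measurableSet_Ioi
  simp only [← Real.exp_add]
  ring_nf

namespace IsExpBoundedSemigroup

variable [CompleteSpace X] {S : ℝ → X →L[ℂ] X} {M ω : ℝ}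

lemma apply_laplace (hS : IsExpBoundedSemigroup S M ω) {μ : ℝ} (hμ : ω < μ) (x : X) {h : ℝ}
    (hh : 0 ≤ h) : S h (hS.weightedIntegral (integrableOn_exp_mul_exp hμ) x) =
      Real.exp (μ * h) • (hS.weightedIntegral (integrableOn_exp_mul_exp hμ) x -
        ∫ s in (0 : ℝ)..h, Real.exp (-μ * s) • S (max s 0) x) := by
  set g : ℝ → X := fun s => Real.exp (-μ * s) • S (max s 0) x with hg
  have hgL : hS.weightedIntegral (integrableOn_exp_mul_exp hμ) x = ∫ s in Set.Ioi 0, g s := by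
    refine setIntegral_congr_fun measurableSet_Ioi fun s hs => ?_
    simp only [hg, max_eq_left (le_of_lt (Set.mem_Ioi.1 hs))]
  have hgint : IntegrableOn g (Set.Ioi 0) := by
    refine (hS.integrableOn_smul (integrableOn_exp_mul_exp hμ) x).congr_fun (fun s hs => ?_)
      measurableSet_Ioi
    simp only [hg, max_eq_left (le_of_lt (Set.mem_Ioi.1 hs))]
  have hshift : ∫ s in Set.Ioi 0, g (s + h) = ∫ s in Set.Ioi h, g s := by
    have := (measurePreserving_add_right volume h).setIntegral_preimage_emb
      (MeasurableEquiv.addRight h).measurableEmbedding g (Set.Ioi h)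
    simpa using this
  rw [map_weightedIntegral, hgL, ← intervalIntegral.integral_interval_add_Ioi hgint
    (hgint.mono_set (Set.Ioi_subset_Ioi hh)), add_sub_cancel_left, ← hshift, ← integral_smul]
  refine setIntegral_congr_fun measurableSet_Ioi fun s hs => ?_
  have hs : 0 < s := hs
  simp only [hg, smul_smul, ← Real.exp_add]
  rw [max_eq_left (by positivity), add_comm s h, hS.add h s hh hs.le]
  simp only [ContinuousLinearMap.comp_apply]
  congr 2
  ring

/-- The Laplace transform of a semigroup at `μ` is a right inverse of `μ - A`. -/
lemma isGenPoint_laplace (hS : IsExpBoundedSemigroup S M ω) {μ : ℝ} (hμ : ω < μ) (x : X) :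
    IsGenPoint S (hS.weightedIntegral (integrableOn_exp_mul_exp hμ) x)
      ((μ : ℂ) • hS.weightedIntegral (integrableOn_exp_mul_exp hμ) x - x) := by
  set L := hS.weightedIntegral (integrableOn_exp_mul_exp hμ) x with hL
  have hgcont : Continuous fun s => Real.exp (-μ * s) • S (max s 0) x :=
    (by fun_prop : Continuous fun s => Real.exp (-μ * s)).smul (hS.continuous_extend x)
  have hexp : HasDerivAt (fun h => Real.exp (μ * h)) μ 0 := by
    simpa using ((hasDerivAt_id (0 : ℝ)).const_mul μ).exp
  have hder := hexp.smul ((hgcont.integral_hasStrictDerivAt 0 0).hasDerivAt.const_sub L)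
  have hslope := (hasDerivWithinAt_iff_tendsto_slope' (s := Set.Ioi (0 : ℝ)) (by simp)).1
    hder.hasDerivWithinAt
  refine (hslope.congr' ?_).trans_eq ?_
  · filter_upwards [self_mem_nhdsWithin] with h hh
    rw [hS.apply_laplace hμ x (le_of_lt hh), slope_def_module, ← Complex.ofReal_inv,
      Complex.coe_smul]
    simp [hL]
  · simp [hS.zero, sub_eq_add_neg, add_comm]

end IsExpBoundedSemigroup

/-- `f` is a weight for which `z ↦ ∫₀^∞ f(s) T_z(s) x ds` converges absolutely and is holomorphic. -/
structure IsHolomorphicWeight (Ω : Set ℂ) (T : ℂ → ℝ → X →L[ℂ] X) (ω : ℝ) (x : X)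
    (f : ℝ → ℝ) : Prop where
  integrableOn : IntegrableOn (fun s => f s * Real.exp (ω * s)) (Set.Ioi 0)
  differentiableOn : DifferentiableOn ℂ (fun z => ∫ s in Set.Ioi 0, f s • T z s x) Ω

/-- Holomorphy of the resolvent at one point `lam` passes to every `μ > ω`. -/
lemma isHolomorphicWeight_exp [CompleteSpace X] {Ω : Set ℂ} {T : ℂ → ℝ → X →L[ℂ] X} {M ω : ℝ}
    (hT : ∀ z ∈ Ω, IsExpBoundedSemigroup (T z) M ω) {lam : ℝ} (hlam : ω < lam)
    {R : ℂ → X →L[ℂ] X}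
    (hR : ∀ z ∈ Ω, ∀ x y : X, IsGenPoint (T z) x y → R z ((lam : ℂ) • x - y) = x)
    (hRholo : DifferentiableOn ℂ R Ω) {μ : ℝ} (hμ : ω < μ) (x : X) :
    IsHolomorphicWeight Ω T ω x (fun s => Real.exp (-μ * s)) := by
  refine ⟨integrableOn_exp_mul_exp hμ, ?_⟩
  set a : ℂ := (lam : ℂ) - μ with ha
  have hunit (z : ℂ) (hz : z ∈ Ω) : IsUnit (1 - a • R z) ∧
      (1 - a • R z) * (hT z hz).weightedIntegral (integrableOn_exp_mul_exp hμ) = R z := by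
    set L := (hT z hz).weightedIntegral (integrableOn_exp_mul_exp hμ) with hL
    have hres : L = R z * (1 + a • L) := by
      ext y
      have h := hR z hz _ _ ((hT z hz).isGenPoint_laplace hμ y)
      rw [← hL] at h
      conv_lhs => rw [← h]
      change _ = R z (y + a • L y)
      congr 1
      rw [ha]
      module
    have hRlam : R z = (hT z hz).weightedIntegral (integrableOn_exp_mul_exp hlam) := by
      ext y
      have h := hR z hz _ _ ((hT z hz).isGenPoint_laplace hlam y)
      simpa using h
    have hcomm : Commute (R z) L := by
      rw [hRlam]
      exact (hT z hz).commute_weightedIntegral _ _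
    have hmul : (1 - a • R z) * L = R z := by
      calc (1 - a • R z) * L = L - a • (R z * L) := by rw [sub_mul, one_mul, smul_mul_assoc]
        _ = R z * (1 + a • L) - a • (R z * L) := by rw [← hres]
        _ = R z := by rw [mul_add, mul_one, mul_smul_comm, add_sub_cancel_right]
    have hinv : (1 - a • R z) * (1 + a • L) = 1 := by
      rw [mul_add, mul_smul_comm, hmul, mul_one, sub_add_cancel]
    have hc : Commute (1 - a • R z) (1 + a • L) :=
      (Commute.one_left _).sub_left
        (((Commute.one_right _).add_right (hcomm.smul_right a)).smul_left a)
    exact ⟨⟨⟨_, _, hinv, hc.eq.symm.trans hinv⟩, rfl⟩, hmul⟩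
  have hdiff : DifferentiableOn ℂ (fun z => Ring.inverse (1 - a • R z) * R z) Ω := by
    intro z hz
    have h1 : DifferentiableWithinAt ℂ (fun z => 1 - a • R z) Ω z :=
      ((hRholo z hz).const_smul a).const_sub 1
    exact ((differentiableAt_inverse (hunit z hz).1).comp_differentiableWithinAt z h1).mul
      (hRholo z hz)
  refine (hdiff.clm_apply (differentiableOn_const x)).congr fun z hz => ?_
  rw [← (hT z hz).weightedIntegral_apply (integrableOn_exp_mul_exp hμ)]
  nth_rewrite 2 [← (hunit z hz).2]
  rw [← mul_assoc, Ring.inverse_mul_cancel _ (hunit z hz).1, one_mul]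

namespace IsHolomorphicWeight

variable {Ω : Set ℂ} {T : ℂ → ℝ → X →L[ℂ] X} {M ω : ℝ} {x : X}

lemma sum (hT : ∀ z ∈ Ω, IsExpBoundedSemigroup (T z) M ω) {ι : Type*} (I : Finset ι)
    {f : ι → ℝ → ℝ} (hf : ∀ i, IsHolomorphicWeight Ω T ω x (f i)) (c : ι → ℝ) :
    IsHolomorphicWeight Ω T ω x (fun s => ∑ i ∈ I, c i * f i s) := by
  constructor
  · simp only [Finset.sum_mul, mul_assoc]
    exact integrable_finsetSum I fun i _ => ((hf i).integrableOn).const_mul (c i)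
  · have h : DifferentiableOn ℂ
        (fun z => ∑ i ∈ I, c i • ∫ s in Set.Ioi 0, f i s • T z s x) Ω :=
      DifferentiableOn.fun_sum fun i _ => (hf i).differentiableOn.const_smul (c i)
    refine h.congr fun z hz => ?_
    simp only [Finset.sum_smul, mul_smul]
    refine (integral_finsetSum I fun i _ =>
      ((hT z hz).integrableOn_smul (hf i).integrableOn x).smul (c i)).trans ?_
    exact Finset.sum_congr rfl fun i _ => integral_smul (c i) _

lemma of_tendsto [CompleteSpace X] (hΩ : IsOpen Ω)
    (hT : ∀ z ∈ Ω, IsExpBoundedSemigroup (T z) M ω) (hM : 0 ≤ M)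
    {f : ℕ → ℝ → ℝ} {F g : ℝ → ℝ} (hf : ∀ n, IsHolomorphicWeight Ω T ω x (f n))
    (hg : IntegrableOn (fun s => g s * Real.exp (ω * s)) (Set.Ioi 0))
    (hfg : ∀ n, ∀ s, 0 < s → |f n s| ≤ g s)
    (hlim : ∀ᵐ s ∂volume.restrict (Set.Ioi 0), Tendsto (fun n => f n s) atTop (𝓝 (F s))) :
    IsHolomorphicWeight Ω T ω x F := by
  have hpos : ∀ᵐ s ∂volume.restrict (Set.Ioi (0 : ℝ)), 0 < s :=
    (ae_restrict_iff' measurableSet_Ioi).2 (Eventually.of_forall fun s hs => hs)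
  have hbound (n : ℕ) (s : ℝ) (hs : 0 < s) :
      ‖f n s * Real.exp (ω * s)‖ ≤ g s * Real.exp (ω * s) := by
    rw [norm_mul, Real.norm_of_nonneg (Real.exp_pos _).le]
    exact mul_le_mul_of_nonneg_right (hfg n s hs) (Real.exp_pos _).le
  constructor
  · have hlim' : ∀ᵐ s ∂volume.restrict (Set.Ioi 0), Tendsto (fun n => f n s * Real.exp (ω * s))
        atTop (𝓝 (F s * Real.exp (ω * s))) := by
      filter_upwards [hlim] with s hs using hs.mul_const _
    refine Integrable.mono' hg (aestronglyMeasurable_of_tendsto_ae atTop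
      (fun n => (hf n).integrableOn.aestronglyMeasurable) hlim') ?_
    filter_upwards [hlim', hpos] with s hs hs0
    exact le_of_tendsto hs.norm (Eventually.of_forall fun n => hbound n s hs0)
  · refine differentiableOn_of_tendsto_of_bounded hΩ
      (C := (M * ∫ s in Set.Ioi 0, g s * Real.exp (ω * s)) * ‖x‖)
      (fun n => (hf n).differentiableOn) (fun n z hz => ?_) fun z hz => ?_
    · refine ((hT z hz).norm_integral_le (hf n).integrableOn x).trans ?_
      refine mul_le_mul_of_nonneg_right (mul_le_mul_of_nonneg_left ?_ hM) (norm_nonneg x)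
      refine integral_mono_ae (hf n).integrableOn.norm hg ?_
      filter_upwards [hpos] with s hs using hbound n s hs
    · refine tendsto_integral_filter_of_dominated_convergence
        (fun s => M * ‖x‖ * (g s * Real.exp (ω * s)))
        (Eventually.of_forall fun n =>
          ((hT z hz).integrableOn_smul (hf n).integrableOn x).aestronglyMeasurable)
        (Eventually.of_forall fun n => ?_) (hg.const_mul _) ?_
      · filter_upwards [hpos] with s hs
        refine ((hT z hz).norm_smul_apply_le (f n) hs.le x).trans ?_
        gcongr
        exact hbound n s hs
      · filter_upwards [hlim] with s hs using hs.smul_const _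

end IsHolomorphicWeight

lemma abs_sum_alternating_le {u : ℝ} (hu : 0 ≤ u) (K : ℕ) :
    |∑ k ∈ Finset.range K, (-1) ^ k / ((k + 1).factorial : ℝ) * u ^ (k + 1)| ≤
      u * Real.exp u := by
  calc _ ≤ ∑ k ∈ Finset.range K, u * (u ^ k / (k.factorial : ℝ)) := by
        refine (Finset.abs_sum_le_sum_abs _ _).trans (Finset.sum_le_sum fun k _ => ?_)
        rw [abs_mul, abs_div, abs_pow, abs_neg, abs_one, one_pow, Nat.abs_cast,
          abs_of_nonneg (by positivity), pow_succ', one_div_mul_eq_div, mul_div_assoc]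
        gcongr
        exact Nat.le_succ k
    _ ≤ u * Real.exp u := by
        rw [← Finset.mul_sum]
        gcongr
        exact Real.sum_le_exp_of_nonneg hu K

lemma tendsto_sum_alternating (u : ℝ) :
    Tendsto (fun K => ∑ k ∈ Finset.range K, (-1) ^ k / ((k + 1).factorial : ℝ) * u ^ (k + 1))
      atTop (𝓝 (1 - Real.exp (-u))) := by
  have h : HasSum (fun k : ℕ => (-u) ^ k / (k.factorial : ℝ)) (Real.exp (-u)) := by
    rw [Real.exp_eq_exp_ℝ]
    exact NormedSpace.expSeries_div_hasSum_exp (-u)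
  have h1 := ((hasSum_nat_add_iff' 1).2 h).neg.tendsto_sum_nat
  simp only [Finset.range_one, Finset.sum_singleton, pow_zero, Nat.factorial_zero, Nat.cast_one,
    div_one, neg_sub] at h1
  refine h1.congr fun K => Finset.sum_congr rfl fun k _ => ?_
  rw [neg_pow u, pow_succ (-1 : ℝ)]
  ring

section Weights

variable [CompleteSpace X] {Ω : Set ℂ} {T : ℂ → ℝ → X →L[ℂ] X} {M ω : ℝ} {x : X}

lemma isHolomorphicWeight_one_sub_exp (hΩ : IsOpen Ω)
    (hT : ∀ z ∈ Ω, IsExpBoundedSemigroup (T z) M ω) (hM : 0 ≤ M)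
    (hexp : ∀ μ, ω < μ → IsHolomorphicWeight Ω T ω x (fun s => Real.exp (-μ * s)))
    {n : ℝ} (hn : 0 ≤ n) (hnω : ω < n) (t : ℝ) :
    IsHolomorphicWeight Ω T ω x (fun s => 1 - Real.exp (-Real.exp (-n * (s - t)))) := by
  have hu (s : ℝ) : Real.exp (-n * (s - t)) = Real.exp (n * t) * Real.exp (-n * s) := by
    rw [← Real.exp_add]; ring_nf
  refine IsHolomorphicWeight.of_tendsto hΩ hT hM
    (f := fun K s => ∑ k ∈ Finset.range K,
      (-1) ^ k / ((k + 1).factorial : ℝ) * Real.exp (-n * (s - t)) ^ (k + 1))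
    (g := fun s => Real.exp (n * t) * Real.exp (Real.exp (n * t)) * Real.exp (-n * s))
    (fun K => ?_) ?_ (fun K s hs => ?_)
    (Eventually.of_forall fun s => tendsto_sum_alternating _)
  · have h := IsHolomorphicWeight.sum hT (Finset.range K)
      (f := fun (k : ℕ) s => Real.exp (-((k + 1) * n) * s))
      (fun k => hexp _ (by nlinarith [(Nat.cast_nonneg k : (0 : ℝ) ≤ k)]))
      (fun k => (-1) ^ k / ((k + 1).factorial : ℝ) * Real.exp (n * t) ^ (k + 1))
    convert h using 3 with s k hk
    rw [hu, mul_pow, mul_assoc, ← Real.exp_nat_mul (-n * s)]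
    push_cast
    ring_nf
  · simp only [mul_assoc]
    exact ((integrableOn_exp_mul_exp hnω).const_mul _).const_mul _
  · refine (abs_sum_alternating_le (Real.exp_pos _).le K).trans ?_
    have hle : Real.exp (-n * (s - t)) ≤ Real.exp (n * t) :=
      Real.exp_le_exp.2 (by nlinarith)
    calc _ ≤ Real.exp (-n * (s - t)) * Real.exp (Real.exp (n * t)) := by gcongr
      _ = _ := by rw [hu]; ring

/-- Phragmén's inversion: `1 - exp (-e^{-n(s-t)})` tends to the indicator function of `s < t`. -/
lemma isHolomorphicWeight_indicator (hΩ : IsOpen Ω)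
    (hT : ∀ z ∈ Ω, IsExpBoundedSemigroup (T z) M ω) (hM : 0 ≤ M)
    (hexp : ∀ μ, ω < μ → IsHolomorphicWeight Ω T ω x (fun s => Real.exp (-μ * s))) (t : ℝ) :
    IsHolomorphicWeight Ω T ω x ((Set.Iic t).indicator 1) := by
  set N : ℝ := |ω| + 1 with hN
  have hNω : ω < N := by linarith [le_abs_self ω]
  have hN0 : 0 ≤ N := by positivity
  refine IsHolomorphicWeight.of_tendsto hΩ hT hM
    (f := fun m s => 1 - Real.exp (-Real.exp (-(N + m) * (s - t))))
    (g := fun s => Real.exp (N * t) * Real.exp (-N * s))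
    (fun m => isHolomorphicWeight_one_sub_exp hΩ hT hM hexp (by positivity)
      (by linarith [(Nat.cast_nonneg m : (0 : ℝ) ≤ m)]) t) ?_ (fun m s _ => ?_) ?_
  · simp only [mul_assoc]
    exact (integrableOn_exp_mul_exp hNω).const_mul _
  · have hm : (0 : ℝ) ≤ m := Nat.cast_nonneg m
    have hpos := Real.exp_pos (-(N + m) * (s - t))
    rw [← Real.exp_add, abs_of_nonneg (by simpa using hpos.le)]
    rcases le_total t s with h | h
    · have h1 := Real.add_one_le_exp (-Real.exp (-(N + m) * (s - t)))
      have h2 : Real.exp (-(N + m) * (s - t)) ≤ Real.exp (N * t + -N * s) :=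
        Real.exp_le_exp.2 (by nlinarith)
      linarith
    · have h1 := Real.exp_pos (-Real.exp (-(N + m) * (s - t)))
      have h2 : 1 ≤ Real.exp (N * t + -N * s) := Real.one_le_exp (by nlinarith)
      linarith
  · have hne : ∀ᵐ s ∂volume.restrict (Set.Ioi (0 : ℝ)), s ≠ t :=
      ae_restrict_of_ae (Measure.ae_ne volume t)
    filter_upwards [hne] with s hs
    have hNm : Tendsto (fun m : ℕ => N + (m : ℝ)) atTop atTop :=
      tendsto_atTop_add_const_left _ _ tendsto_natCast_atTop_atTop
    rcases lt_or_gt_of_ne hs with h | h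
    · have h1 : Tendsto (fun m : ℕ => -(N + (m : ℝ)) * (s - t)) atTop atTop := by
        refine (hNm.atTop_mul_const (sub_pos.2 h)).congr fun m => ?_
        ring
      have h2 := (Real.tendsto_exp_neg_atTop_nhds_zero.comp
        (Real.tendsto_exp_atTop.comp h1)).const_sub 1
      simpa [Set.indicator, h.le, Function.comp_def] using h2
    · have h1 : Tendsto (fun m : ℕ => -(N + (m : ℝ)) * (s - t)) atTop atBot := by
        refine (tendsto_neg_atTop_atBot.comp (hNm.atTop_mul_const (sub_pos.2 h))).congr fun m => ?_
        simp only [Function.comp_apply, neg_mul]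
      have h2 := (Real.continuous_exp.tendsto _).comp (Real.tendsto_exp_atBot.comp h1).neg
      simpa [Set.indicator, h.not_ge, Function.comp_def] using h2.const_sub 1

lemma differentiableOn_semigroup_apply (hΩ : IsOpen Ω)
    (hT : ∀ z ∈ Ω, IsExpBoundedSemigroup (T z) M ω) (hM : 0 ≤ M)
    (hexp : ∀ μ, ω < μ → IsHolomorphicWeight Ω T ω x (fun s => Real.exp (-μ * s)))
    {t : ℝ} (ht : 0 ≤ t) : DifferentiableOn ℂ (fun z => T z t x) Ω := by
  have hprim (r : ℝ) (hr : 0 ≤ r) :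
      DifferentiableOn ℂ (fun z => ∫ s in (0 : ℝ)..r, T z (max s 0) x) Ω := by
    refine (isHolomorphicWeight_indicator hΩ hT hM hexp r).differentiableOn.congr fun z _ => ?_
    rw [intervalIntegral.integral_of_le hr, ← Set.Ioi_inter_Iic,
      ← setIntegral_indicator measurableSet_Iic]
    refine setIntegral_congr_fun measurableSet_Ioi fun s hs => ?_
    by_cases h : s ≤ r <;> simp [Set.indicator, h, max_eq_left (le_of_lt (Set.mem_Ioi.1 hs))]
  have hstep (m : ℕ) : (0 : ℝ) < 1 / ((m : ℝ) + 1) := by positivity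
  have hint (z : ℂ) (hz : z ∈ Ω) (a b : ℝ) :
      IntervalIntegrable (fun s => T z (max s 0) x) volume a b :=
    ((hT z hz).continuous_extend x).intervalIntegrable a b
  refine differentiableOn_of_tendsto_of_bounded hΩ
    (F := fun m z => (1 / ((m : ℝ) + 1))⁻¹ • ((∫ s in (0 : ℝ)..t + 1 / ((m : ℝ) + 1),
      T z (max s 0) x) - ∫ s in (0 : ℝ)..t, T z (max s 0) x))
    (C := M * Real.exp (|ω| * (t + 1)) * ‖x‖) (fun m => ?_) (fun m z hz => ?_) fun z hz => ?_
  · exact ((hprim _ (by positivity)).sub (hprim t ht)).const_smul _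
  · rw [intervalIntegral.integral_interval_sub_left (hint z hz _ _) (hint z hz _ _), norm_smul,
      norm_inv, Real.norm_of_nonneg (hstep m).le, inv_mul_le_iff₀ (hstep m), mul_comm]
    have hm1 : 1 / ((m : ℝ) + 1) ≤ 1 := by
      rw [div_le_one (by positivity)]; linarith [(Nat.cast_nonneg m : (0 : ℝ) ≤ m)]
    refine (intervalIntegral.norm_integral_le_of_norm_le_const
      (C := M * Real.exp (|ω| * (t + 1)) * ‖x‖) fun s hs => ?_).trans_eq ?_
    · rw [Set.uIoc_of_le (by linarith [hstep m])] at hs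
      have hs0 : 0 ≤ s := ht.trans hs.1.le
      rw [max_eq_left hs0]
      refine ((hT z hz).norm_apply_le hs0 x).trans ?_
      gcongr
      · exact le_abs_self ω
      · linarith [hs.2]
    · rw [add_sub_cancel_left, abs_of_pos (hstep m)]
  · have hder := (((hT z hz).continuous_extend x).integral_hasStrictDerivAt 0 t).hasDerivAt
    have hslope := hder.tendsto_slope_zero_right
    rw [max_eq_left ht] at hslope
    exact hslope.comp (tendsto_nhdsWithin_iff.2
      ⟨tendsto_one_div_add_atTop_nhds_zero_nat, Eventually.of_forall hstep⟩)

end Weights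

lemma ContinuousLinearMap.opNorm_le_of_unit_sphere {A : X →L[ℂ] X} {C : ℝ} (hC : 0 ≤ C)
    (h : ∀ x : {x : X // ‖x‖ = 1}, ‖A x‖ ≤ C) : ‖A‖ ≤ C := by
  refine A.opNorm_le_bound' hC fun x hx => ?_
  have hunit : ‖((‖x‖ : ℂ)⁻¹) • x‖ = 1 := by
    rw [norm_smul, norm_inv, Complex.norm_real, norm_norm, inv_mul_cancel₀ hx]
  have := h ⟨_, hunit⟩
  rwa [map_smul, norm_smul, norm_inv, Complex.norm_real, norm_norm,
    inv_mul_le_iff₀ (lt_of_le_of_ne (norm_nonneg x) (Ne.symm hx)), mul_comm] at this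

end HolomorphicSemigroups

/-- Holomorphic dependence of `C₀`-semigroups (Theorem 2 of the paper): if the
semigroups `T_z`, `z ∈ Ω`, satisfy `sup {e^{−ωt} ‖T_z(t)‖ : t ≥ 0, z ∈ Ω} = M < ∞`
and `z ↦ (λ − A_z)⁻¹` is holomorphic for some `λ > ω`, then `z ↦ T_z(t) ∈ L(X)`
is holomorphic for every `t ≥ 0`, and `z ↦ T_z(·)x ∈ C([0,t₁]; X)` is
holomorphic for every `x ∈ X` and `t₁ > 0`. -/
theorem semigroups_depend_holomorphically
    (X : Type*) [NormedAddCommGroup X] [NormedSpace ℂ X] [CompleteSpace X]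
    (Ω : Set ℂ) (hΩ : IsOpen Ω)
    (T : ℂ → ℝ → X →L[ℂ] X) (M ω : ℝ)
    (hT0 : ∀ z ∈ Ω, T z 0 = 1)
    (hTadd : ∀ z ∈ Ω, ∀ s t : ℝ, 0 ≤ s → 0 ≤ t →
      T z (s + t) = (T z s).comp (T z t))
    (hTcont : ∀ z ∈ Ω, ∀ x : X, ContinuousOn (fun t : ℝ => T z t x) (Set.Ici 0))
    (hTbound : ∀ z ∈ Ω, ∀ t : ℝ, 0 ≤ t → Real.exp (-ω * t) * ‖T z t‖ ≤ M)
    (lam : ℝ) (hlam : ω < lam) (R : ℂ → X →L[ℂ] X)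
    (hR : ∀ z ∈ Ω, ∀ x : X, IsGenPoint (T z) (R z x) ((lam : ℂ) • R z x - x))
    (hR' : ∀ z ∈ Ω, ∀ x y : X, IsGenPoint (T z) x y → R z ((lam : ℂ) • x - y) = x)
    (hRholo : DifferentiableOn ℂ R Ω) :
    (∀ t : ℝ, 0 ≤ t → DifferentiableOn ℂ (fun z => T z t) Ω) ∧
    (∀ x : X, ∀ t₁ : ℝ, 0 < t₁ → ∃ F : ℂ → C(Set.Icc (0 : ℝ) t₁, X),
      (∀ z ∈ Ω, ∀ t : Set.Icc (0 : ℝ) t₁, F z t = T z t x) ∧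
      DifferentiableOn ℂ F Ω) := by
  have hT : ∀ z ∈ Ω, IsExpBoundedSemigroup (T z) |M| ω := fun z hz =>
    { zero := hT0 z hz
      add := hTadd z hz
      cont := hTcont z hz
      bound := fun t ht => by
        have h := (hTbound z hz t ht).trans (le_abs_self M)
        rwa [neg_mul, Real.exp_neg, inv_mul_le_iff₀ (Real.exp_pos _), mul_comm] at h }
  have hpoint (x : X) (t : ℝ) (ht : 0 ≤ t) : DifferentiableOn ℂ (fun z => T z t x) Ω :=
    differentiableOn_semigroup_apply hΩ hT (abs_nonneg M)
      (fun μ hμ => isHolomorphicWeight_exp hT hlam hR' hRholo hμ x) ht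
  refine ⟨fun t ht => ?_, fun x t₁ ht₁ => ?_⟩
  · refine differentiableOn_of_norming hΩ
      (fun x : {x : X // ‖x‖ = 1} => ContinuousLinearMap.apply ℂ X (x : X))
      (fun A C hC h => ContinuousLinearMap.opNorm_le_of_unit_sphere hC h)
      (C := |M| * Real.exp (ω * t)) (fun x => hpoint x t ht) fun x z hz => ?_
    simpa [x.2] using (hT z hz).norm_apply_le ht (x : X)
  · classical
    have hcont (z : ℂ) (hz : z ∈ Ω) : Continuous fun t : Set.Icc (0 : ℝ) t₁ => T z t x :=
      (hTcont z hz x).comp_continuous continuous_subtype_val fun t => t.2.1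
    set F : ℂ → C(Set.Icc (0 : ℝ) t₁, X) := fun z => if hz : z ∈ Ω then ⟨_, hcont z hz⟩ else 0
    have hF (z : ℂ) (hz : z ∈ Ω) (t : Set.Icc (0 : ℝ) t₁) : F z t = T z t x := by simp [F, hz]
    refine ⟨F, hF, differentiableOn_of_norming hΩ
      (fun t : Set.Icc (0 : ℝ) t₁ => ContinuousMap.evalCLM ℂ t)
      (fun f C hC h => (ContinuousMap.norm_le f hC).2 h)
      (C := |M| * Real.exp (|ω| * t₁) * ‖x‖)
      (fun t => (hpoint x t t.2.1).congr fun z hz => hF z hz t) fun t z hz => ?_⟩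
    change ‖F z t‖ ≤ _
    rw [hF z hz]
    refine ((hT z hz).norm_apply_le t.2.1 x).trans ?_
    gcongr
    · exact t.2.1
    · exact le_abs_self ω
    · exact t.2.2
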